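/- (Gehring's lemma, parabolic form.) Let n ≥ 2, let A ⊆ ℝ^{n+1} be open and let g be a measurable function on A with |g|² locally integrable on A. Let q ∈ [1,2), ĉ ≥ 1 and θ ≥ 0, and suppose that ⨍_{Q_{ρ/8}} |g|² dx dt ≤ ĉ ( ⨍_{Q_ρ} |g|^q dx dt )^{2/q} + θ ⨍_{Q_ρ} |g|² dx dt for every parabolic cylinder Q_ρ with Q_ρ ⊆ A, where Q_{ρ/8} is concentric with Q_ρ. Then there exists θ₀ > 0 depending only on n and q such that, if θ < θ₀, there exist an exponent χ₁ > 1 and a constant c ≥ 1, both depending only on n, ĉ, q and θ, such that |g|^{2χ₁} is locally integrable on A and ( ⨍_{Q_{ρ/2}} |g|^{2χ₁} dx dt )^{1/χ₁} ≤ c ⨍_{Q_ρ} |g|² dx dt for every parabolic cylinder Q_ρ with Q_ρ ⊆ A. -/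

import Mathlib

open MeasureTheory Set ENNReal

/-- The (backward) parabolic cylinder `Q_R(x₀,t₀) = B(x₀,R) × (t₀ - R², t₀) ⊆ ℝⁿ × ℝ`. -/
def parabolicCylinder (n : ℕ) (x₀ : EuclideanSpace ℝ (Fin n)) (t₀ R : ℝ) :
    Set (EuclideanSpace ℝ (Fin n) × ℝ) :=
  (Metric.ball x₀ R) ×ˢ (Set.Ioo (t₀ - R ^ 2) t₀)

/-- The integral average `⨍_Q |g|^e` (as an extended nonnegative real) of `|g|^e` over `Q`. -/
noncomputable def cylAvg {n : ℕ} (Q : Set (EuclideanSpace ℝ (Fin n) × ℝ))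
    (g : EuclideanSpace ℝ (Fin n) × ℝ → ℝ) (e : ℝ) : ℝ≥0∞ :=
  (volume Q)⁻¹ * ∫⁻ p in Q, ENNReal.ofReal (|g p| ^ e)


lemma diff_generic {X : Type*} [MetricSpace X] [MeasurableSpace X] [BorelSpace X]
    [SecondCountableTopology X] (μ : Measure X) [IsLocallyFiniteMeasure μ] (C : NNReal)
    (hC : ∀ x, ∀ r > 0, μ (Metric.closedBall x (3 * r)) ≤ C * μ (Metric.closedBall x r))
    (f : X → ℝ≥0∞) (hf : Measurable f) (hfin : ∫⁻ x, f x ∂μ ≠ ∞) :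
    ∀ᵐ x ∂μ, ∀ a < f x, ∀ δ > 0, ∃ r, 0 < r ∧ r < δ ∧
      a * μ (Metric.closedBall x r) ≤ ∫⁻ y in Metric.closedBall x r, f y ∂μ := by
  have hfreq : ∀ x, ∃ᶠ r in nhdsWithin (0:ℝ) (Ioi 0),
      μ (Metric.closedBall x (3 * r)) ≤ C * μ (Metric.closedBall x r) := by
    intro x
    apply Filter.Eventually.frequently
    filter_upwards [self_mem_nhdsWithin] with r hr using hC x r hr
  let v := Vitali.vitaliFamily μ C hfreq
  filter_upwards [v.ae_tendsto_lintegral_div' hf hfin] with x hx a ha δ hδ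
  have ev := hx.eventually (lt_mem_nhds ha)
  rw [VitaliFamily.eventually_filterAt_iff] at ev
  obtain ⟨ε, hε, H⟩ := ev
  have hr : 0 < min ε (δ / 2) := by positivity
  refine ⟨min ε (δ / 2), hr, (min_le_right _ _).trans_lt (by linarith), ?_⟩
  have := H (Metric.closedBall x (min ε (δ / 2))) ?_ (Metric.closedBall_subset_closedBall (min_le_left _ _))
  · exact ENNReal.mul_le_of_le_div this.le
  · refine ⟨Metric.isClosed_closedBall, ⟨x, ?_⟩, _, subset_rfl, hC x _ hr⟩
    exact mem_interior_iff_mem_nhds.2 (Metric.closedBall_mem_nhds x hr)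

abbrev PSnow := Metric.Snowflaking ℝ (1/2 : ℝ) (by norm_num) (by norm_num)

lemma box_vol (n : ℕ) (x : EuclideanSpace ℝ (Fin n)) (t r : ℝ) (hr : 0 ≤ r) :
    volume (Metric.closedBall x r ×ˢ Icc (t - r ^ 2) (t + r ^ 2)) =
      2 * (volume (Metric.ball (0 : EuclideanSpace ℝ (Fin n)) 1) * ENNReal.ofReal (r ^ (n + 2))) := by
  rw [Measure.volume_eq_prod, Measure.prod_prod, Measure.addHaar_closedBall _ _ hr, Real.volume_Icc,
    show t + r ^ 2 - (t - r ^ 2) = 2 * r ^ 2 by ring, ENNReal.ofReal_mul (by norm_num), pow_add,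
    ENNReal.ofReal_mul (by positivity)]
  simp
  ring

lemma diff_box (n : ℕ) (f : EuclideanSpace ℝ (Fin n) × ℝ → ℝ≥0∞) (hf : Measurable f)
    (hfin : ∫⁻ x, f x ≠ ∞) :
    ∀ᵐ z : EuclideanSpace ℝ (Fin n) × ℝ, ∀ a < f z, ∀ δ > 0, ∃ r, 0 < r ∧ r < δ ∧
      a * volume (Metric.closedBall z.1 r ×ˢ Icc (z.2 - r ^ 2) (z.2 + r ^ 2)) ≤
        ∫⁻ y in Metric.closedBall z.1 r ×ˢ Icc (z.2 - r ^ 2) (z.2 + r ^ 2), f y := by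
  letI : MeasurableSpace PSnow := borel _
  haveI : BorelSpace PSnow := ⟨rfl⟩
  let e : (EuclideanSpace ℝ (Fin n) × ℝ) ≃ₜ (EuclideanSpace ℝ (Fin n) × PSnow) :=
    (Homeomorph.refl _).prodCongr Metric.Snowflaking.homeomorph.symm
  let e' := e.toMeasurableEquiv
  let μ : Measure (EuclideanSpace ℝ (Fin n) × PSnow) := Measure.map e' volume
  have pre : ∀ z r, 0 ≤ r → e' ⁻¹' (Metric.closedBall (e' z) r) =
      Metric.closedBall z.1 r ×ˢ Icc (z.2 - r ^ 2) (z.2 + r ^ 2) := by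
    intro z r hr
    ext w
    have h1 : e' w = (w.1, Metric.Snowflaking.toSnowflaking w.2) := rfl
    have h2 : e' z = (z.1, Metric.Snowflaking.toSnowflaking z.2) := rfl
    rw [mem_preimage, h1, h2, Metric.mem_closedBall, Prod.dist_eq, max_le_iff, mem_prod,
      Metric.mem_closedBall, ← Real.closedBall_eq_Icc, Metric.mem_closedBall]
    refine and_congr_right fun _ => ?_
    simp only [Metric.Snowflaking.dist_toSnowflaking_toSnowflaking]
    rw [← Real.sqrt_eq_rpow, Real.sqrt_le_left hr]
  have vol : ∀ z r, 0 ≤ r → μ (Metric.closedBall (e' z) r) =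
      2 * (volume (Metric.ball (0 : EuclideanSpace ℝ (Fin n)) 1) * ENNReal.ofReal (r ^ (n + 2))) := by
    intro z r hr
    rw [e'.map_apply, pre z r hr, box_vol n _ _ _ hr]
  have surj : ∀ w, ∃ z, e' z = w := e'.surjective
  have hfinB : ∀ x r, μ (Metric.closedBall x r) ≠ ∞ := by
    intro w r
    obtain ⟨z, rfl⟩ := surj w
    rcases le_or_gt 0 r with hr | hr
    · rw [vol z r hr]
      exact ENNReal.mul_ne_top (by simp) (ENNReal.mul_ne_top measure_ball_lt_top.ne ofReal_ne_top)
    · rw [Metric.closedBall_eq_empty.2 hr]; simp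
  haveI : IsLocallyFiniteMeasure μ := by
    refine ⟨fun w => ⟨Metric.closedBall w 1, Metric.closedBall_mem_nhds w one_pos, ?_⟩⟩
    exact (hfinB w 1).lt_top
  have key := diff_generic μ (3 ^ (n + 2)) ?_ (f ∘ e'.symm) (hf.comp e'.symm.measurable) ?_
  · have key2 := ae_of_ae_map e'.measurable.aemeasurable (μ := volume) key
    filter_upwards [key2] with z hz a ha δ hδ
    obtain ⟨r, hr, hrδ, H⟩ := hz a (by simpa using ha) δ hδ
    refine ⟨r, hr, hrδ, ?_⟩
    rw [← pre z r hr.le]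
    rw [e'.map_apply, setLIntegral_map Metric.isClosed_closedBall.measurableSet
      (hf.comp e'.symm.measurable) e'.measurable] at H
    simpa using H
  · intro w r hr
    obtain ⟨z, rfl⟩ := surj w
    rw [vol z r hr.le, vol z _ (by positivity), mul_pow, ENNReal.ofReal_mul (by positivity)]
    apply le_of_eq
    push_cast
    rw [ENNReal.ofReal_pow (by norm_num)]
    simp
    ring
  · rw [lintegral_map_equiv]
    simpa using hfin

lemma cyl_vol (n : ℕ) (x : EuclideanSpace ℝ (Fin n)) (t r : ℝ) (hr : 0 < r) :
    volume (parabolicCylinder n x t r) =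
      volume (Metric.ball (0 : EuclideanSpace ℝ (Fin n)) 1) * ENNReal.ofReal (r ^ (n + 2)) := by
  rw [parabolicCylinder, Measure.volume_eq_prod, Measure.prod_prod,
    Measure.addHaar_ball_of_pos _ _ hr, Real.volume_Ioo,
    show t - (t - r ^ 2) = r ^ 2 by ring, pow_add,
    ENNReal.ofReal_mul (by positivity)]
  simp
  ring

lemma cyl_vol_ne_top (n : ℕ) (x : EuclideanSpace ℝ (Fin n)) (t r : ℝ) (hr : 0 < r) :
    volume (parabolicCylinder n x t r) ≠ ∞ := by
  rw [cyl_vol n x t r hr]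
  exact ENNReal.mul_ne_top measure_ball_lt_top.ne ofReal_ne_top

lemma cyl_vol_ne_zero (n : ℕ) (x : EuclideanSpace ℝ (Fin n)) (t r : ℝ) (hr : 0 < r) :
    volume (parabolicCylinder n x t r) ≠ 0 := by
  rw [cyl_vol n x t r hr]
  refine mul_ne_zero (Metric.measure_ball_pos _ _ one_pos).ne' ?_
  simp only [ne_eq, ENNReal.ofReal_eq_zero, not_le]; positivity

lemma cyl_vol_mul (n : ℕ) (x x' : EuclideanSpace ℝ (Fin n)) (t t' r k : ℝ) (hr : 0 < r) (hk : 0 < k) :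
    volume (parabolicCylinder n x t (k * r)) =
      ENNReal.ofReal (k ^ (n + 2)) * volume (parabolicCylinder n x' t' r) := by
  rw [cyl_vol n x t _ (by positivity), cyl_vol n x' t' r hr, mul_pow,
    ENNReal.ofReal_mul (by positivity)]
  ring

lemma cyl_open (n : ℕ) (x : EuclideanSpace ℝ (Fin n)) (t r : ℝ) :
    IsOpen (parabolicCylinder n x t r) := Metric.isOpen_ball.prod isOpen_Ioo

lemma diff_cyl (n : ℕ) (f : EuclideanSpace ℝ (Fin n) × ℝ → ℝ≥0∞) (hf : Measurable f)
    (hfin : ∫⁻ x, f x ≠ ∞) :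
    ∀ᵐ z : EuclideanSpace ℝ (Fin n) × ℝ, ∀ a < f z, ∀ δ > 0, ∃ r, 0 < r ∧ r < δ ∧
      a * volume (parabolicCylinder n z.1 (z.2 + r ^ 2 / 2) r) ≤
        ENNReal.ofReal (2 ^ (n + 2)) * ∫⁻ y in parabolicCylinder n z.1 (z.2 + r ^ 2 / 2) r, f y := by
  filter_upwards [diff_box n f hf hfin] with z hz a ha δ hδ
  obtain ⟨r, hr, hrδ, H⟩ := hz a ha (δ / 2) (by positivity)
  refine ⟨2 * r, by positivity, by linarith, ?_⟩
  rw [cyl_vol_mul n _ z.1 _ z.2 r 2 hr two_pos, mul_left_comm]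
  refine mul_le_mul_right (le_trans (mul_le_mul_right ?_ _) (H.trans ?_)) _
  · apply measure_mono
    refine prod_mono Metric.ball_subset_closedBall fun s hs => ⟨hs.1.le, ?_⟩
    have := hs.2
    nlinarith
  · apply lintegral_mono_set
    refine prod_mono (Metric.closedBall_subset_ball (by linarith)) fun s hs => ?_
    constructor <;> nlinarith [hs.1, hs.2, sq_pos_of_pos hr]


lemma gl_step1 {α : Type*} [MeasurableSpace α] (ν : Measure α) (h : α → ℝ) (hm : Measurable h)
    (h0 : ∀ x, 0 ≤ h x) (p C1 C2 η l0 ε T : ℝ) (hp1 : p < 1)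
    (hC1 : 1 ≤ C1) (hη0 : 0 < η) (hC2 : 0 ≤ C2) (hl0 : 0 ≤ l0)
    (hε0 : 0 < ε) (hT : 0 < T)
    (hgood : ∀ l, l0 < l → ∫⁻ x in {x | C1 * l < h x}, ENNReal.ofReal (h x) ∂ν ≤
      ENNReal.ofReal (C2 * l ^ (1 - p)) *
        ∫⁻ x in {x | η * l < h x}, ENNReal.ofReal (h x ^ p) ∂ν) :
    ∫⁻ x, ENNReal.ofReal (min (h x / C1) T ^ ε) ∂(ν.withDensity fun x => ENNReal.ofReal (h x)) ≤
      ENNReal.ofReal (l0 ^ ε) * ∫⁻ x, ENNReal.ofReal (h x) ∂ν +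
      ENNReal.ofReal (ε * C2 / (1 - p + ε)) *
        ∫⁻ x, ENNReal.ofReal (min (h x / η) T ^ (1 - p + ε))
          ∂(ν.withDensity fun x => ENNReal.ofReal (h x ^ p)) := by
  have hC10 : 0 < C1 := by linarith
  have hs : 0 < 1 - p + ε := by linarith
  set μ := ν.withDensity fun x => ENNReal.ofReal (h x) with hμ
  set μ' := ν.withDensity fun x => ENNReal.ofReal (h x ^ p) with hμ'
  rw [lintegral_rpow_eq_lintegral_meas_lt_mul μ
      (Filter.Eventually.of_forall fun x => le_min (div_nonneg (h0 x) hC10.le) hT.le)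
      ((hm.div_const _).min measurable_const).aemeasurable hε0,
    lintegral_rpow_eq_lintegral_meas_lt_mul μ'
      (Filter.Eventually.of_forall fun x => le_min (div_nonneg (h0 x) hη0.le) hT.le)
      ((hm.div_const _).min measurable_const).aemeasurable hs]
  have hsplit : Ioi (0:ℝ) = Ioc 0 l0 ∪ Ioi l0 := by
    rw [Ioc_union_Ioi_eq_Ioi hl0]
  have hM : ∀ s, μ s ≤ ∫⁻ x, ENNReal.ofReal (h x) ∂ν := by
    intro s
    calc μ s ≤ μ univ := measure_mono (subset_univ _)
      _ = _ := by rw [hμ, withDensity_apply _ MeasurableSet.univ, Measure.restrict_univ]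
  have hint : ∫⁻ t in Ioc 0 l0, ENNReal.ofReal (t ^ (ε - 1)) = ENNReal.ofReal (l0 ^ ε / ε) := by
    rw [← ofReal_integral_eq_lintegral_ofReal]
    · rw [← intervalIntegral.integral_of_le hl0, integral_rpow (Or.inl (by linarith))]
      simp [hε0.ne']
    · have := intervalIntegral.intervalIntegrable_rpow' (a := 0) (b := l0) (r := ε - 1) (by linarith)
      rwa [intervalIntegrable_iff_integrableOn_Ioc_of_le hl0] at this
    · filter_upwards [ae_restrict_mem measurableSet_Ioc] with t ht
      exact Real.rpow_nonneg ht.1.le _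
  have h1 : ∫⁻ t in Ioc 0 l0, μ {a | t < min (h a / C1) T} * ENNReal.ofReal (t ^ (ε - 1)) ≤
      (∫⁻ x, ENNReal.ofReal (h x) ∂ν) * ENNReal.ofReal (l0 ^ ε / ε) := by
    rw [← hint, ← lintegral_const_mul _ (by fun_prop)]
    exact lintegral_mono fun t => mul_le_mul_left (hM _) _
  have h2 : ∫⁻ t in Ioi l0, μ {a | t < min (h a / C1) T} * ENNReal.ofReal (t ^ (ε - 1)) ≤
      ENNReal.ofReal C2 *
      ∫⁻ t in Ioi 0, μ' {a | t < min (h a / η) T} * ENNReal.ofReal (t ^ (1 - p + ε - 1)) := by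
    rw [← lintegral_const_mul' _ _ ofReal_ne_top]
    refine le_trans ?_ (lintegral_mono_set (Ioi_subset_Ioi hl0))
    refine setLIntegral_mono' measurableSet_Ioi fun t ht => ?_
    have ht : l0 < t := ht
    have ht0 : 0 < t := lt_of_le_of_lt hl0 ht
    by_cases htT : t < T
    · have e1 : {a | t < min (h a / C1) T} = {x | C1 * t < h x} := by
        ext x; simp [lt_div_iff₀ hC10, htT, mul_comm]
      have e2 : {a | t < min (h a / η) T} = {x | η * t < h x} := by
        ext x; simp [lt_div_iff₀ hη0, htT, mul_comm]
      rw [e1, e2, hμ, hμ', withDensity_apply _ (measurableSet_lt measurable_const hm),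
        withDensity_apply _ (measurableSet_lt measurable_const hm)]
      refine (mul_le_mul_left (hgood t ht) _).trans (le_of_eq ?_)
      rw [show 1 - p + ε - 1 = (1 - p) + (ε - 1) by ring, Real.rpow_add ht0,
        ENNReal.ofReal_mul hC2, ENNReal.ofReal_mul (Real.rpow_nonneg ht0.le _)]
      ring
    · have e1 : {a | t < min (h a / C1) T} = ∅ := by
        ext x; simp [htT]
      rw [e1]; simp
  rw [hsplit, ← hsplit]
  conv_lhs => rw [hsplit]
  refine (mul_le_mul_right (lintegral_union_le _ _ _) _).trans ?_
  refine (mul_le_mul_right (add_le_add h1 h2) _).trans ?_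
  rw [mul_add]
  refine add_le_add (le_of_eq ?_) (le_of_eq ?_)
  · rw [mul_comm (∫⁻ x, ENNReal.ofReal (h x) ∂ν), ← mul_assoc, ← ENNReal.ofReal_mul hε0.le]
    congr 2; field_simp
  · rw [← mul_assoc, ← mul_assoc, ← ENNReal.ofReal_mul hε0.le, ← ENNReal.ofReal_mul (by positivity)]
    congr 2; field_simp

lemma gl_step2 {α : Type*} [MeasurableSpace α] (ν : Measure α) (h : α → ℝ) (hm : Measurable h)
    (h0 : ∀ x, 0 ≤ h x) (hfin : ∫⁻ x, ENNReal.ofReal (h x) ∂ν ≠ ∞)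
    (p C1 C2 η l0 ε T : ℝ) (hp0 : 0 < p) (hp1 : p < 1)
    (hC1 : 1 ≤ C1) (hη0 : 0 < η) (hη1 : η ≤ 1) (hC2 : 0 ≤ C2) (hl0 : 0 ≤ l0)
    (hε0 : 0 < ε) (hε1 : ε ≤ 1) (hT : 0 < T)
    (hε : ε * C2 * η ^ (p - 1) / (1 - p) ≤ η / (2 * C1))
    (hgood : ∀ l, l0 < l → ∫⁻ x in {x | C1 * l < h x}, ENNReal.ofReal (h x) ∂ν ≤
      ENNReal.ofReal (C2 * l ^ (1 - p)) *
        ∫⁻ x in {x | η * l < h x}, ENNReal.ofReal (h x ^ p) ∂ν) :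
    ∫⁻ x, ENNReal.ofReal (h x * min (h x / η) T ^ ε) ∂ν ≤
      ENNReal.ofReal (2 * C1 / η * l0 ^ ε) * ∫⁻ x, ENNReal.ofReal (h x) ∂ν := by
  have hC10 : 0 < C1 := by linarith
  have key := gl_step1 ν h hm h0 p C1 C2 η l0 ε T hp1 hC1 hη0 hC2 hl0 hε0 hT hgood
  rw [lintegral_withDensity_eq_lintegral_mul _ (by fun_prop) (by fun_prop),
    lintegral_withDensity_eq_lintegral_mul _ (by fun_prop) (by fun_prop)] at key
  simp only [Pi.mul_apply] at key
  set M := ∫⁻ x, ENNReal.ofReal (h x) ∂ν with hM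
  set J := ∫⁻ x, ENNReal.ofReal (h x * min (h x / η) T ^ ε) ∂ν with hJ
  have mn : ∀ x, 0 ≤ min (h x / η) T := fun x => le_min (div_nonneg (h0 x) hη0.le) hT.le
  have hJfin : J ≠ ∞ := by
    refine ne_top_of_le_ne_top (ENNReal.mul_ne_top (ofReal_ne_top (r := T ^ ε)) hfin) ?_
    rw [← lintegral_const_mul' _ _ ofReal_ne_top]
    refine lintegral_mono fun x => ?_
    rw [← ENNReal.ofReal_mul (by positivity), mul_comm (T ^ ε)]
    apply ENNReal.ofReal_le_ofReal
    exact mul_le_mul_of_nonneg_left (Real.rpow_le_rpow (mn x) (min_le_right _ _) hε0.le) (h0 x)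
  have hL : ENNReal.ofReal (η / C1) * J ≤
      ∫⁻ x, ENNReal.ofReal (h x) * ENNReal.ofReal (min (h x / C1) T ^ ε) ∂ν := by
    rw [← lintegral_const_mul' _ _ ofReal_ne_top]
    refine lintegral_mono fun x => ?_
    simp only
    rw [← ENNReal.ofReal_mul (by positivity), ← ENNReal.ofReal_mul (h0 x)]
    apply ENNReal.ofReal_le_ofReal
    have hle1 : η / C1 ≤ 1 := by rw [div_le_one hC10]; linarith
    have a1 : η / C1 * min (h x / η) T ≤ min (h x / C1) T := by
      refine le_min ?_ ?_
      · calc η / C1 * min (h x / η) T ≤ η / C1 * (h x / η) := by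
              gcongr; exact min_le_left _ _
          _ = h x / C1 := by field_simp
      · calc η / C1 * min (h x / η) T ≤ 1 * T :=
              mul_le_mul hle1 (min_le_right _ _) (mn x) zero_le_one
          _ = T := one_mul _
    have a2 : (η / C1) * min (h x / η) T ^ ε ≤ min (h x / C1) T ^ ε := by
      calc (η / C1) * min (h x / η) T ^ ε ≤ (η / C1) ^ ε * min (h x / η) T ^ ε := by
            apply mul_le_mul_of_nonneg_right _ (Real.rpow_nonneg (mn x) _)
            exact Real.self_le_rpow_of_le_one (by positivity) hle1 hε1
        _ = (η / C1 * min (h x / η) T) ^ ε := by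
            rw [Real.mul_rpow (by positivity) (mn x)]
        _ ≤ _ := Real.rpow_le_rpow (mul_nonneg (by positivity) (mn x)) a1 hε0.le
    nlinarith [h0 x]
  have hR : ENNReal.ofReal (ε * C2 / (1 - p + ε)) *
      ∫⁻ x, ENNReal.ofReal (h x ^ p) * ENNReal.ofReal (min (h x / η) T ^ (1 - p + ε)) ∂ν ≤
      ENNReal.ofReal (η / (2 * C1)) * J := by
    have : ∫⁻ x, ENNReal.ofReal (h x ^ p) * ENNReal.ofReal (min (h x / η) T ^ (1 - p + ε)) ∂ν ≤
        ENNReal.ofReal (η ^ (p - 1)) * J := by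
      rw [← lintegral_const_mul' _ _ ofReal_ne_top]
      refine lintegral_mono fun x => ?_
      simp only
      rw [← ENNReal.ofReal_mul (Real.rpow_nonneg (h0 x) _),
        ← ENNReal.ofReal_mul (Real.rpow_nonneg hη0.le _)]
      apply ENNReal.ofReal_le_ofReal
      rw [Real.rpow_add_of_nonneg (mn x) (by linarith) hε0.le]
      have b1 : min (h x / η) T ^ (1 - p) ≤ (h x / η) ^ (1 - p) :=
        Real.rpow_le_rpow (mn x) (min_le_left _ _) (by linarith)
      calc h x ^ p * (min (h x / η) T ^ (1 - p) * min (h x / η) T ^ ε)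
          ≤ h x ^ p * ((h x / η) ^ (1 - p) * min (h x / η) T ^ ε) := by
            apply mul_le_mul_of_nonneg_left _ (Real.rpow_nonneg (h0 x) _)
            exact mul_le_mul_of_nonneg_right b1 (Real.rpow_nonneg (mn x) _)
        _ = (h x ^ p * h x ^ (1 - p)) * η ^ (p - 1) * min (h x / η) T ^ ε := by
            rw [Real.div_rpow (h0 x) hη0.le, show p - 1 = -(1 - p) by ring, Real.rpow_neg hη0.le]
            ring
        _ = h x * η ^ (p - 1) * min (h x / η) T ^ ε := by
            rw [← Real.rpow_add_of_nonneg (h0 x) hp0.le (by linarith)]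
            simp
        _ = _ := by ring
    refine (mul_le_mul_right this _).trans ?_
    rw [← mul_assoc, ← ENNReal.ofReal_mul (by apply div_nonneg <;> nlinarith)]
    refine mul_le_mul_left (ENNReal.ofReal_le_ofReal (le_trans ?_ hε)) _
    rw [div_mul_eq_mul_div]
    apply div_le_div_of_nonneg_left (by positivity) (by linarith) (by linarith)
  have fin := hL.trans (key.trans (add_le_add_right hR _))
  have e : ENNReal.ofReal (η / C1) = ENNReal.ofReal (η / (2 * C1)) + ENNReal.ofReal (η / (2 * C1)) := by
    rw [← ENNReal.ofReal_add (by positivity) (by positivity)]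
    congr 1; field_simp; norm_num
  rw [e, add_mul] at fin
  have fin2 := (ENNReal.add_le_add_iff_right (ENNReal.mul_ne_top ofReal_ne_top hJfin)).1 fin
  calc J = ENNReal.ofReal (2 * C1 / η) * (ENNReal.ofReal (η / (2 * C1)) * J) := by
        rw [← mul_assoc, ← ENNReal.ofReal_mul (by positivity)]
        rw [show 2 * C1 / η * (η / (2 * C1)) = 1 by field_simp]; simp
    _ ≤ ENNReal.ofReal (2 * C1 / η) * (ENNReal.ofReal (l0 ^ ε) * M) := mul_le_mul_right fin2 _
    _ = _ := by rw [← mul_assoc, ← ENNReal.ofReal_mul (by positivity)]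

lemma good_lambda {α : Type*} [MeasurableSpace α] (ν : Measure α) (h : α → ℝ) (hm : Measurable h)
    (h0 : ∀ x, 0 ≤ h x) (hfin : ∫⁻ x, ENNReal.ofReal (h x) ∂ν ≠ ∞)
    (p C1 C2 η l0 ε : ℝ) (hp0 : 0 < p) (hp1 : p < 1)
    (hC1 : 1 ≤ C1) (hη0 : 0 < η) (hη1 : η ≤ 1) (hC2 : 0 ≤ C2) (hl0 : 0 ≤ l0)
    (hε0 : 0 < ε) (hε1 : ε ≤ 1)
    (hε : ε * C2 * η ^ (p - 1) / (1 - p) ≤ η / (2 * C1))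
    (hgood : ∀ l, l0 < l → ∫⁻ x in {x | C1 * l < h x}, ENNReal.ofReal (h x) ∂ν ≤
      ENNReal.ofReal (C2 * l ^ (1 - p)) *
        ∫⁻ x in {x | η * l < h x}, ENNReal.ofReal (h x ^ p) ∂ν) :
    ∫⁻ x, ENNReal.ofReal (h x ^ (1 + ε)) ∂ν ≤
      ENNReal.ofReal (2 * C1 / η * l0 ^ ε) * ∫⁻ x, ENNReal.ofReal (h x) ∂ν := by
  have lim : Filter.Tendsto (fun k : ℕ => ∫⁻ x, ENNReal.ofReal (h x * min (h x / η) (k + 1) ^ ε) ∂ν)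
      Filter.atTop (nhds (∫⁻ x, ENNReal.ofReal (h x * (h x / η) ^ ε) ∂ν)) := by
    refine lintegral_tendsto_of_tendsto_of_monotone (fun k => by fun_prop) ?_ ?_
    · refine Filter.Eventually.of_forall fun x k m hkm => ENNReal.ofReal_le_ofReal ?_
      apply mul_le_mul_of_nonneg_left _ (h0 x)
      apply Real.rpow_le_rpow _ _ hε0.le
      · exact le_min (div_nonneg (h0 x) hη0.le) (by positivity)
      · apply min_le_min le_rfl; gcongr
    · refine Filter.Eventually.of_forall fun x => ?_
      apply tendsto_const_nhds.congr'
      obtain ⟨k0, hk0⟩ := exists_nat_ge (h x / η)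
      filter_upwards [Filter.eventually_ge_atTop k0] with k hk
      have : h x / η ≤ (k : ℝ) + 1 := by
        have : (k0 : ℝ) ≤ k := by exact_mod_cast hk
        linarith
      rw [min_eq_left this]
  have := le_of_tendsto' lim fun k => gl_step2 ν h hm h0 hfin p C1 C2 η l0 ε (k + 1) hp0 hp1 hC1 hη0
    hη1 hC2 hl0 hε0 hε1 (by positivity) hε hgood
  refine le_trans (lintegral_mono fun x => ENNReal.ofReal_le_ofReal ?_) this
  rw [Real.rpow_add_of_nonneg (h0 x) zero_le_one hε0.le, Real.rpow_one]
  apply mul_le_mul_of_nonneg_left _ (h0 x)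
  apply Real.rpow_le_rpow (h0 x) _ hε0.le
  rw [le_div_iff₀ hη0]; nlinarith [h0 x]


/-- parabolic depth of a point in the cylinder `Q_ρ(x0,t0)` -/
noncomputable def pdepth {n : ℕ} (x0 : EuclideanSpace ℝ (Fin n)) (t0 ρ : ℝ)
    (z : EuclideanSpace ℝ (Fin n) × ℝ) : ℝ :=
  ρ - max (dist z.1 x0) (Real.sqrt (t0 - z.2))

/-- the weight `(depth/ρ)^(n+2)` -/
noncomputable def pweight {n : ℕ} (x0 : EuclideanSpace ℝ (Fin n)) (t0 ρ : ℝ)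
    (z : EuclideanSpace ℝ (Fin n) × ℝ) : ℝ :=
  (max (pdepth x0 t0 ρ z) 0 / ρ) ^ (n + 2)

section geom
variable {n : ℕ} {x0 : EuclideanSpace ℝ (Fin n)} {t0 ρ : ℝ}

lemma pweight_nonneg (hρ : 0 < ρ) (z) : 0 ≤ pweight x0 t0 ρ z := by
  unfold pweight; positivity

lemma pweight_measurable : Measurable (pweight x0 t0 ρ) := by
  unfold pweight pdepth; fun_prop

lemma mem_cyl_iff_depth (R : ℝ) (hR : 0 < R) (z) :
    z ∈ parabolicCylinder n x0 t0 R ↔ z.2 < t0 ∧ ρ - R < pdepth x0 t0 ρ z := by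
  unfold parabolicCylinder pdepth
  simp only [mem_prod, Metric.mem_ball, mem_Ioo]
  constructor
  · rintro ⟨h1, h2, h3⟩
    refine ⟨h3, ?_⟩
    have : Real.sqrt (t0 - z.2) < R := by
      rw [Real.sqrt_lt' hR]; linarith
    have := max_lt h1 this
    linarith
  · rintro ⟨h3, h⟩
    have hm : max (dist z.1 x0) (Real.sqrt (t0 - z.2)) < R := by linarith
    rw [max_lt_iff, Real.sqrt_lt' hR] at hm
    exact ⟨hm.1, by linarith [hm.2], h3⟩

lemma mem_cyl0 (hρ : 0 < ρ) (z) :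
    z ∈ parabolicCylinder n x0 t0 ρ ↔ z.2 < t0 ∧ 0 < pdepth x0 t0 ρ z := by
  rw [mem_cyl_iff_depth (ρ := ρ) ρ hρ]; simp

lemma depth_osc {y : EuclideanSpace ℝ (Fin n)} {s r : ℝ} (hr : 0 < r) {z z'}
    (hz : z ∈ parabolicCylinder n y s r) (hz' : z' ∈ parabolicCylinder n y s r) :
    pdepth x0 t0 ρ z ≤ pdepth x0 t0 ρ z' + 2 * r := by
  unfold pdepth
  obtain ⟨a1, a2, a3⟩ := hz
  obtain ⟨b1, b2, b3⟩ := hz'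
  rw [Metric.mem_ball] at a1 b1
  have h1 : dist z'.1 x0 ≤ dist z.1 x0 + 2 * r := by
    have := dist_triangle z'.1 y x0
    have := dist_triangle y z.1 x0
    rw [dist_comm y z.1] at this
    linarith
  have h2 : Real.sqrt (t0 - z'.2) ≤ Real.sqrt (t0 - z.2) + 2 * r := by
    rw [Real.sqrt_le_left (by positivity)]
    have h3 : t0 - z.2 ≤ Real.sqrt (t0 - z.2) ^ 2 := by
      rcases le_total 0 (t0 - z.2) with h | h
      · rw [Real.sq_sqrt h]
      · nlinarith [sq_nonneg (Real.sqrt (t0 - z.2))]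
    nlinarith [Real.sqrt_nonneg (t0 - z.2), mul_nonneg (Real.sqrt_nonneg (t0 - z.2)) hr.le]
  have := max_le_max h1 h2
  rw [max_add_add_right] at this
  linarith

lemma cyl_sub {y : EuclideanSpace ℝ (Fin n)} {s r : ℝ} (hρ : 0 < ρ) (hr : 0 < r) {z} (hs : s ≤ t0)
    (hz : z ∈ parabolicCylinder n y s r) (hd : 4 * r ≤ pdepth x0 t0 ρ z) :
    parabolicCylinder n y s r ⊆ parabolicCylinder n x0 t0 ρ := by
  intro z' hz'
  rw [mem_cyl0 hρ]
  refine ⟨lt_of_lt_of_le hz'.2.2 hs, ?_⟩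
  have := depth_osc (x0 := x0) (t0 := t0) (ρ := ρ) hr hz hz'
  linarith

lemma weight_osc {y : EuclideanSpace ℝ (Fin n)} {s r : ℝ} (hρ : 0 < ρ) (hr : 0 < r) {z z'}
    (hz : z ∈ parabolicCylinder n y s r) (hd : 4 * r ≤ pdepth x0 t0 ρ z)
    (hz' : z' ∈ parabolicCylinder n y s r) :
    pweight x0 t0 ρ z ≤ 2 ^ (n + 2) * pweight x0 t0 ρ z' ∧
    pweight x0 t0 ρ z' ≤ 2 ^ (n + 2) * pweight x0 t0 ρ z := by
  have h1 := depth_osc (x0 := x0) (t0 := t0) (ρ := ρ) hr hz hz'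
  have h2 := depth_osc (x0 := x0) (t0 := t0) (ρ := ρ) hr hz' hz
  have e1 : max (pdepth x0 t0 ρ z) 0 = pdepth x0 t0 ρ z := max_eq_left (by linarith)
  have e2 : max (pdepth x0 t0 ρ z') 0 = pdepth x0 t0 ρ z' := max_eq_left (by linarith)
  unfold pweight
  rw [← mul_pow, ← mul_pow, e1, e2]
  constructor
  · apply pow_le_pow_left₀ (div_nonneg (by linarith) hρ.le)
    rw [← mul_div_assoc]; apply div_le_div_of_nonneg_right _ hρ.le; linarith
  · apply pow_le_pow_left₀ (div_nonneg (by linarith) hρ.le)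
    rw [← mul_div_assoc]; apply div_le_div_of_nonneg_right _ hρ.le; linarith

lemma weight_pos (hρ : 0 < ρ) {z} (hz : 0 < pdepth x0 t0 ρ z) : 0 < pweight x0 t0 ρ z := by
  unfold pweight
  rw [max_eq_left hz.le]; positivity

/-- Vitali enlargement of intersecting parabolic cylinders. -/
lemma cyl_enlarge {ya yb : EuclideanSpace ℝ (Fin n)} {sa sb ra rb : ℝ} (ha : 0 < ra) (hb : 0 < rb)
    (hab : ra ≤ 2 * rb) (hsa : sa ≤ t0) (hsb : sb ≤ t0)
    (hne : (parabolicCylinder n ya sa ra ∩ parabolicCylinder n yb sb rb).Nonempty) :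
    parabolicCylinder n ya sa ra ⊆ parabolicCylinder n yb (min (sb + 4 * rb ^ 2) t0) (5 * rb) := by
  obtain ⟨w, ⟨w1, w2, w3⟩, ⟨v1, v2, v3⟩⟩ := hne
  rintro z ⟨z1, z2, z3⟩
  rw [Metric.mem_ball] at *
  have hsq : ra ^ 2 ≤ 4 * rb ^ 2 := by nlinarith
  have hm := min_le_left (sb + 4 * rb ^ 2) t0
  refine ⟨?_, ?_, ?_⟩
  · rw [Metric.mem_ball]
    have := dist_triangle z.1 ya yb
    have := dist_triangle ya w.1 yb
    rw [dist_comm ya w.1] at this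
    linarith
  · nlinarith
  · apply lt_min <;> linarith

end geom

lemma exit_cyl {n : ℕ} {x0 : EuclideanSpace ℝ (Fin n)} {t0 ρ : ℝ} (hρ : 0 < ρ)
    (F : EuclideanSpace ℝ (Fin n) × ℝ → ℝ≥0∞) (Em K l : ℝ) (hEm : 0 ≤ Em) (hK : 0 < K)
    (hl0 : 0 < l) (hl : K ^ (n + 2) * Em ≤ l)
    (hF : ∫⁻ z, F z ≤ ENNReal.ofReal Em * volume (parabolicCylinder n x0 t0 ρ))
    (z : EuclideanSpace ℝ (Fin n) × ℝ) (hz : 0 < pdepth x0 t0 ρ z)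
    (h : ∃ r y s, 0 < r ∧ s ≤ t0 ∧ z ∈ parabolicCylinder n y s r ∧
      ENNReal.ofReal l * volume (parabolicCylinder n y s r) <
        ENNReal.ofReal (pweight x0 t0 ρ z) * ∫⁻ y in parabolicCylinder n y s r, F y) :
    ∃ r y s, 0 < r ∧ s ≤ t0 ∧ z ∈ parabolicCylinder n y s r ∧
      ENNReal.ofReal l * volume (parabolicCylinder n y s r) <
        ENNReal.ofReal (pweight x0 t0 ρ z) * ∫⁻ y in parabolicCylinder n y s r, F y ∧
      K * r ≤ pdepth x0 t0 ρ z ∧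
      ∀ r' y' s', 2 * r ≤ r' → s' ≤ t0 → z ∈ parabolicCylinder n y' s' r' →
        ENNReal.ofReal (pweight x0 t0 ρ z) * ∫⁻ y in parabolicCylinder n y' s' r', F y ≤
          ENNReal.ofReal l * volume (parabolicCylinder n y' s' r') := by
  let S : Set ℝ := {r | ∃ y s, 0 < r ∧ s ≤ t0 ∧ z ∈ parabolicCylinder n y s r ∧
      ENNReal.ofReal l * volume (parabolicCylinder n y s r) <
        ENNReal.ofReal (pweight x0 t0 ρ z) * ∫⁻ y in parabolicCylinder n y s r, F y}
  have hb : ∀ r ∈ S, K * r ≤ pdepth x0 t0 ρ z := by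
    rintro r ⟨y, s, hr, hs, hzr, hlt⟩
    have h1 := hlt.trans_le (mul_le_mul_right ((setLIntegral_le_lintegral _ _).trans hF) _)
    rw [cyl_vol n _ _ _ hr, cyl_vol n _ _ _ hρ, mul_left_comm, mul_left_comm (ENNReal.ofReal Em),
      mul_left_comm (ENNReal.ofReal (pweight x0 t0 ρ z))] at h1
    have h2 := lt_of_mul_lt_mul_left' h1
    rw [← ENNReal.ofReal_mul hl0.le, ← ENNReal.ofReal_mul hEm, ← ENNReal.ofReal_mul
      (pweight_nonneg hρ z)] at h2
    have h3 := (ENNReal.ofReal_lt_ofReal_iff_of_nonneg (by positivity)).1 h2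
    unfold pweight at h3
    rw [max_eq_left hz.le, div_pow] at h3
    have e : pdepth x0 t0 ρ z ^ (n + 2) / ρ ^ (n + 2) * (Em * ρ ^ (n + 2)) =
      pdepth x0 t0 ρ z ^ (n + 2) * Em := by field_simp
    rw [e] at h3
    have h4 : (K * r) ^ (n + 2) * Em < pdepth x0 t0 ρ z ^ (n + 2) * Em := by
      refine lt_of_le_of_lt ?_ h3
      rw [mul_pow]
      have : 0 < r ^ (n + 2) := by positivity
      nlinarith
    have h5 := lt_of_mul_lt_mul_right h4 hEm
    exact (lt_of_pow_lt_pow_left₀ _ hz.le h5).le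
  have hbdd : BddAbove S := ⟨pdepth x0 t0 ρ z / K, fun r hr => by
    rw [le_div_iff₀ hK, mul_comm]; exact hb r hr⟩
  obtain ⟨r0, y0, s0, h0⟩ := h
  have hr0 : r0 ∈ S := ⟨y0, s0, h0⟩
  have hsup : 0 < sSup S := lt_of_lt_of_le h0.1 (le_csSup hbdd hr0)
  obtain ⟨r, hrS, hr⟩ := exists_lt_of_lt_csSup ⟨r0, hr0⟩ (half_lt_self hsup)
  obtain ⟨y, s, a1, a2, a3, a4⟩ := id hrS
  refine ⟨r, y, s, a1, a2, a3, a4, hb r hrS, ?_⟩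
  intro r' y' s' hr' hs' hz'
  by_contra hcon
  have : r' ∈ S := ⟨y', s', by linarith, hs', hz', not_le.1 hcon⟩
  have := le_csSup hbdd this
  linarith


lemma ball_est {n : ℕ} {x0 : EuclideanSpace ℝ (Fin n)} {t0 ρ : ℝ} (hρ : 0 < ρ)
    (f : EuclideanSpace ℝ (Fin n) × ℝ → ℝ) (hf : Measurable f) (hf0 : ∀ z, 0 ≤ f z)
    (p c θ l : ℝ) (hp0 : 0 < p) (hc : 1 ≤ c) (hθ0 : 0 ≤ θ) (hθ : θ ≤ 1 / 2)
    (hl0 : 0 < l)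
    (RH : ∀ y s r, 0 < r → parabolicCylinder n y s r ⊆ parabolicCylinder n x0 t0 ρ →
      (volume (parabolicCylinder n y s (r / 8)))⁻¹ *
          ∫⁻ z in parabolicCylinder n y s (r / 8), ENNReal.ofReal (f z) ≤
        ENNReal.ofReal c * ((volume (parabolicCylinder n y s r))⁻¹ *
          ∫⁻ z in parabolicCylinder n y s r, ENNReal.ofReal (f z ^ p)) ^ (1 / p) +
        ENNReal.ofReal θ * ((volume (parabolicCylinder n y s r))⁻¹ *
          ∫⁻ z in parabolicCylinder n y s r, ENNReal.ofReal (f z)))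
    (z : EuclideanSpace ℝ (Fin n) × ℝ) (r s : ℝ) (y : EuclideanSpace ℝ (Fin n))
    (hr : 0 < r) (hs : s ≤ t0) (hz : z ∈ parabolicCylinder n y s r)
    (hlt : ENNReal.ofReal l * volume (parabolicCylinder n y s r) <
        ENNReal.ofReal (pweight x0 t0 ρ z) * ∫⁻ y in parabolicCylinder n y s r, ENNReal.ofReal (f y))
    (hd : 160 * r ≤ pdepth x0 t0 ρ z)
    (hmaxr : ∀ r' y' s', 2 * r ≤ r' → s' ≤ t0 → z ∈ parabolicCylinder n y' s' r' →
        parabolicCylinder n y' s' r' ⊆ parabolicCylinder n x0 t0 ρ →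
        ENNReal.ofReal (pweight x0 t0 ρ z) * ∫⁻ y in parabolicCylinder n y' s' r', ENNReal.ofReal (f y) ≤
          ENNReal.ofReal l * volume (parabolicCylinder n y' s' r')) :
    ∫⁻ w in parabolicCylinder n y (min (s + 4 * (8 * r) ^ 2) t0) (5 * (8 * r)),
      ENNReal.ofReal (f w * pweight x0 t0 ρ w) ≤
    ENNReal.ofReal (10 ^ (n + 2) * (2 * (2 * c * 2 ^ (n + 2)) ^ p) * l ^ (1 - p)) *
      ∫⁻ w in parabolicCylinder n y s (8 * r) ∩
        {w | (2 * c * 2 ^ (n + 2))⁻¹ * (2⁻¹ : ℝ) ^ (1 / p) * l < f w * pweight x0 t0 ρ w},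
        ENNReal.ofReal ((f w * pweight x0 t0 ρ w) ^ p) := by
  set W := pweight x0 t0 ρ z with hW
  set c1 := 2 * c * 2 ^ (n + 2) with hc1
  set η := c1⁻¹ * (2⁻¹ : ℝ) ^ (1 / p) with hη
  set h : EuclideanSpace ℝ (Fin n) × ℝ → ℝ := fun w => f w * pweight x0 t0 ρ w with hh
  have hW0 : 0 < W := weight_pos hρ (by linarith)
  have hc10 : 0 < c1 := by positivity
  have h8 : 0 < 8 * r := by positivity
  have hh0 : ∀ w, 0 ≤ h w := fun w => mul_nonneg (hf0 w) (pweight_nonneg hρ w)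
  have hhm : Measurable h := hf.mul pweight_measurable
  set Q := parabolicCylinder n y s (8 * r) with hQ
  have hQv0 : volume Q ≠ 0 := cyl_vol_ne_zero n y s _ h8
  have hQvt : volume Q ≠ ∞ := cyl_vol_ne_top n y s _ h8
  have hQ1v0 : volume (parabolicCylinder n y s r) ≠ 0 := cyl_vol_ne_zero n y s _ hr
  have hQ1vt : volume (parabolicCylinder n y s r) ≠ ∞ := cyl_vol_ne_top n y s _ hr
  have hQm : MeasurableSet Q := (cyl_open n y s _).measurableSet
  have hzQ : z ∈ Q := by
    obtain ⟨a1, a2, a3⟩ := hz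
    refine ⟨Metric.ball_subset_ball (by linarith) a1, by nlinarith, a3⟩
  have hQsub := cyl_sub hρ h8 hs hzQ (by linarith : 4 * (8 * r) ≤ pdepth x0 t0 ρ z)
  have hzS : z ∈ parabolicCylinder n y (min (s + 4 * (8 * r) ^ 2) t0) (5 * (8 * r)) :=
    cyl_enlarge h8 h8 (by linarith) hs hs ⟨z, hzQ, hzQ⟩ hzQ
  have hSsub := cyl_sub hρ (by positivity) (min_le_right _ _) hzS
    (by linarith : 4 * (5 * (8 * r)) ≤ pdepth x0 t0 ρ z)
  -- part (i)
  have part1 : ∫⁻ w in parabolicCylinder n y (min (s + 4 * (8 * r) ^ 2) t0) (5 * (8 * r)),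
      ENNReal.ofReal (h w) ≤ ENNReal.ofReal (10 ^ (n + 2) * l) * volume Q := by
    calc _ ≤ ∫⁻ w in parabolicCylinder n y (min (s + 4 * (8 * r) ^ 2) t0) (5 * (8 * r)),
          ENNReal.ofReal (2 ^ (n + 2)) * (ENNReal.ofReal W * ENNReal.ofReal (f w)) := by
          refine setLIntegral_mono' (cyl_open n _ _ _).measurableSet fun w hw => ?_
          rw [← ENNReal.ofReal_mul hW0.le, ← ENNReal.ofReal_mul (by positivity)]
          apply ENNReal.ofReal_le_ofReal
          have := (weight_osc hρ (by positivity) hzS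
            (by linarith : 4 * (5 * (8 * r)) ≤ pdepth x0 t0 ρ z) hw).2
          simp only [hh]
          nlinarith [mul_le_mul_of_nonneg_left this (hf0 w)]
      _ = ENNReal.ofReal (2 ^ (n + 2)) * (ENNReal.ofReal W *
          ∫⁻ w in parabolicCylinder n y (min (s + 4 * (8 * r) ^ 2) t0) (5 * (8 * r)),
            ENNReal.ofReal (f w)) := by
          rw [lintegral_const_mul' _ _ ofReal_ne_top, lintegral_const_mul' _ _ ofReal_ne_top]
      _ ≤ ENNReal.ofReal (2 ^ (n + 2)) * (ENNReal.ofReal l *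
          volume (parabolicCylinder n y (min (s + 4 * (8 * r) ^ 2) t0) (5 * (8 * r)))) :=
          mul_le_mul_right (hmaxr _ _ _ (by linarith) (min_le_right _ _) hzS hSsub) _
      _ = _ := by
          rw [cyl_vol_mul n y y _ s (8 * r) 5 h8 (by norm_num), ← mul_assoc, ← mul_assoc,
            ← ENNReal.ofReal_mul (by positivity), ← ENNReal.ofReal_mul (by positivity)]
          congr 2
          rw [show (10 : ℝ) = 2 * 5 by norm_num, mul_pow]; ring
  -- part (ii)
  set Av := (volume Q)⁻¹ * ∫⁻ w in Q, ENNReal.ofReal (f w ^ p) with hAv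
  have rh := RH y s (8 * r) h8 hQsub
  rw [show 8 * r / 8 = r by ring] at rh
  have i1 : ENNReal.ofReal l ≤ ENNReal.ofReal W * ((volume (parabolicCylinder n y s r))⁻¹ *
      ∫⁻ y in parabolicCylinder n y s r, ENNReal.ofReal (f y)) := by
    rw [mul_left_comm, mul_comm, ← div_eq_mul_inv,
      ENNReal.le_div_iff_mul_le (Or.inl hQ1v0) (Or.inl hQ1vt)]
    exact hlt.le
  have i2 : ENNReal.ofReal W * ((volume Q)⁻¹ * ∫⁻ y in Q, ENNReal.ofReal (f y)) ≤
      ENNReal.ofReal l := by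
    rw [mul_left_comm, mul_comm, ← div_eq_mul_inv]
    exact ENNReal.div_le_of_le_mul (hmaxr _ _ _ (by linarith) hs hzQ hQsub)
  have i3 : ENNReal.ofReal l ≤ ENNReal.ofReal (W * c) * Av ^ (1 / p) + ENNReal.ofReal (l / 2) := by
    calc ENNReal.ofReal l ≤ _ := i1
      _ ≤ _ := mul_le_mul_right rh _
      _ = ENNReal.ofReal (W * c) * Av ^ (1 / p) + ENNReal.ofReal θ *
          (ENNReal.ofReal W * ((volume Q)⁻¹ * ∫⁻ y in Q, ENNReal.ofReal (f y))) := by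
          rw [ENNReal.ofReal_mul hW0.le]; ring
      _ ≤ _ := by
          refine add_le_add_right ((mul_le_mul_right i2 _).trans ?_) _
          rw [← ENNReal.ofReal_mul hθ0]
          apply ENNReal.ofReal_le_ofReal
          nlinarith
  have i4 : ENNReal.ofReal (l / 2) ≤ ENNReal.ofReal (W * c) * Av ^ (1 / p) := by
    have e : ENNReal.ofReal l = ENNReal.ofReal (l / 2) + ENNReal.ofReal (l / 2) := by
      rw [← ENNReal.ofReal_add (by positivity) (by positivity)]; congr 1; ring
    rw [e] at i3
    exact (ENNReal.add_le_add_iff_right ofReal_ne_top).1 i3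
  have i5 : ENNReal.ofReal ((l / (2 * c * W)) ^ p) ≤ Av := by
    have : ENNReal.ofReal (l / (2 * c * W)) ≤ Av ^ (1 / p) := by
      calc ENNReal.ofReal (l / (2 * c * W)) = ENNReal.ofReal ((W * c)⁻¹) * ENNReal.ofReal (l / 2) := by
            rw [← ENNReal.ofReal_mul (by positivity)]; congr 1; field_simp
        _ ≤ ENNReal.ofReal ((W * c)⁻¹) * (ENNReal.ofReal (W * c) * Av ^ (1 / p)) :=
            mul_le_mul_right i4 _
        _ = Av ^ (1 / p) := by
            rw [← mul_assoc, ← ENNReal.ofReal_mul (by positivity),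
              inv_mul_cancel₀ (by positivity)]; simp
    have := ENNReal.rpow_le_rpow this hp0.le
    rwa [← ENNReal.rpow_mul, one_div_mul_cancel hp0.ne', ENNReal.rpow_one,
      ENNReal.ofReal_rpow_of_pos (by positivity)] at this
  have i6 : ENNReal.ofReal ((l / (2 * c * W)) ^ p) * volume Q ≤ ∫⁻ w in Q, ENNReal.ofReal (f w ^ p) := by
    rw [← ENNReal.le_div_iff_mul_le (Or.inl hQv0) (Or.inl hQvt)]
    refine i5.trans (le_of_eq ?_)
    rw [hAv, mul_comm, ← div_eq_mul_inv]
  have i7 : ∫⁻ w in Q, ENNReal.ofReal (f w ^ p) ≤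
      ENNReal.ofReal ((2 ^ (n + 2) / W) ^ p) * ∫⁻ w in Q, ENNReal.ofReal (h w ^ p) := by
    rw [← lintegral_const_mul' _ _ ofReal_ne_top]
    refine setLIntegral_mono' hQm fun w hw => ?_
    rw [← ENNReal.ofReal_mul (by positivity), ← Real.mul_rpow (by positivity) (hh0 w)]
    apply ENNReal.ofReal_le_ofReal
    apply Real.rpow_le_rpow (hf0 w) _ hp0.le
    have := (weight_osc hρ h8 hzQ (by linarith : 4 * (8 * r) ≤ pdepth x0 t0 ρ z) hw).1
    rw [div_mul_eq_mul_div, le_div_iff₀ hW0]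
    simp only [hh]
    nlinarith [mul_le_mul_of_nonneg_left this (hf0 w)]
  have i8 : ENNReal.ofReal ((l / c1) ^ p) * volume Q ≤ ∫⁻ w in Q, ENNReal.ofReal (h w ^ p) := by
    calc ENNReal.ofReal ((l / c1) ^ p) * volume Q
        = ENNReal.ofReal ((W / 2 ^ (n + 2)) ^ p) *
          (ENNReal.ofReal ((l / (2 * c * W)) ^ p) * volume Q) := by
          rw [← mul_assoc, ← ENNReal.ofReal_mul (by positivity),
            ← Real.mul_rpow (by positivity) (by positivity)]
          congr 3; rw [hc1]; field_simp
      _ ≤ ENNReal.ofReal ((W / 2 ^ (n + 2)) ^ p) *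
          (ENNReal.ofReal ((2 ^ (n + 2) / W) ^ p) * ∫⁻ w in Q, ENNReal.ofReal (h w ^ p)) :=
          mul_le_mul_right (i6.trans i7) _
      _ = _ := by
          rw [← mul_assoc, ← ENNReal.ofReal_mul (by positivity),
            ← Real.mul_rpow (by positivity) (by positivity)]
          rw [show W / 2 ^ (n + 2) * (2 ^ (n + 2) / W) = 1 by field_simp]; simp
  set I := ∫⁻ w in Q ∩ {w | η * l < h w}, ENNReal.ofReal (h w ^ p) with hI
  have hηl : (η * l) ^ p = 1 / 2 * (l / c1) ^ p := by
    rw [hη, show c1⁻¹ * (2⁻¹ : ℝ) ^ (1 / p) * l = (2⁻¹ : ℝ) ^ (1 / p) * (l / c1) by ring,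
      Real.mul_rpow (by positivity) (by positivity), ← Real.rpow_mul (by norm_num),
      one_div_mul_cancel hp0.ne']
    norm_num
  have i9 : ∫⁻ w in Q, ENNReal.ofReal (h w ^ p) ≤ I + ENNReal.ofReal (1 / 2 * (l / c1) ^ p) * volume Q := by
    have hms : MeasurableSet {w | η * l < h w} := measurableSet_lt measurable_const hhm
    rw [← lintegral_inter_add_sdiff _ Q hms]
    refine add_le_add_right ?_ _
    rw [← hηl]
    calc ∫⁻ w in Q \ {w | η * l < h w}, ENNReal.ofReal (h w ^ p)
        ≤ ∫⁻ w in Q \ {w | η * l < h w}, ENNReal.ofReal ((η * l) ^ p) := by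
          refine setLIntegral_mono' (hQm.diff hms) fun w hw => ?_
          apply ENNReal.ofReal_le_ofReal
          exact Real.rpow_le_rpow (hh0 w) (not_lt.1 hw.2) hp0.le
      _ = ENNReal.ofReal ((η * l) ^ p) * volume (Q \ {w | η * l < h w}) := by
          rw [setLIntegral_const]
      _ ≤ _ := mul_le_mul_right (measure_mono sdiff_subset) _
  have i10 : ENNReal.ofReal (1 / 2 * (l / c1) ^ p) * volume Q ≤ I := by
    have e : ENNReal.ofReal ((l / c1) ^ p) * volume Q =
        ENNReal.ofReal (1 / 2 * (l / c1) ^ p) * volume Q +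
        ENNReal.ofReal (1 / 2 * (l / c1) ^ p) * volume Q := by
      rw [← add_mul, ← ENNReal.ofReal_add (by positivity) (by positivity)]; congr 2; ring
    have := i8.trans i9
    rw [e] at this
    exact (ENNReal.add_le_add_iff_right (ENNReal.mul_ne_top ofReal_ne_top hQvt)).1 this
  refine part1.trans ?_
  calc ENNReal.ofReal (10 ^ (n + 2) * l) * volume Q
      = ENNReal.ofReal (10 ^ (n + 2) * (2 * c1 ^ p) * l ^ (1 - p)) *
        (ENNReal.ofReal (1 / 2 * (l / c1) ^ p) * volume Q) := by
        rw [← mul_assoc, ← ENNReal.ofReal_mul (by positivity)]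
        congr 2
        rw [Real.div_rpow hl0.le hc10.le]
        have : l = l ^ (1 - p) * l ^ p := by
          rw [← Real.rpow_add hl0]; simp
        have h3 : c1 ^ p ≠ 0 := by positivity
        conv_lhs => rw [this]
        field_simp
    _ ≤ _ := mul_le_mul_right i10 _


lemma cover_est {n : ℕ} {x0 : EuclideanSpace ℝ (Fin n)} {t0 ρ : ℝ} (hρ : 0 < ρ)
    (f : EuclideanSpace ℝ (Fin n) × ℝ → ℝ) (hf : Measurable f) (hf0 : ∀ z, 0 ≤ f z)
    (p c θ l Em : ℝ) (hp0 : 0 < p) (hc : 1 ≤ c) (hθ0 : 0 ≤ θ) (hθ : θ ≤ 1 / 2)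
    (hEm : 0 ≤ Em) (hl : 160 ^ (n + 2) * Em < l)
    (hF : ∫⁻ z in parabolicCylinder n x0 t0 ρ, ENNReal.ofReal (f z) ≤
      ENNReal.ofReal Em * volume (parabolicCylinder n x0 t0 ρ))
    (RH : ∀ y s r, 0 < r → parabolicCylinder n y s r ⊆ parabolicCylinder n x0 t0 ρ →
      (volume (parabolicCylinder n y s (r / 8)))⁻¹ *
          ∫⁻ z in parabolicCylinder n y s (r / 8), ENNReal.ofReal (f z) ≤
        ENNReal.ofReal c * ((volume (parabolicCylinder n y s r))⁻¹ *
          ∫⁻ z in parabolicCylinder n y s r, ENNReal.ofReal (f z ^ p)) ^ (1 / p) +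
        ENNReal.ofReal θ * ((volume (parabolicCylinder n y s r))⁻¹ *
          ∫⁻ z in parabolicCylinder n y s r, ENNReal.ofReal (f z))) :
    ∫⁻ w in {w | 2 ^ (n + 2) * l < f w * pweight x0 t0 ρ w},
      ENNReal.ofReal (f w * pweight x0 t0 ρ w) ∂(volume.restrict (parabolicCylinder n x0 t0 ρ)) ≤
    ENNReal.ofReal (10 ^ (n + 2) * (2 * (2 * c * 2 ^ (n + 2)) ^ p) * l ^ (1 - p)) *
      ∫⁻ w in {w | (2 * c * 2 ^ (n + 2))⁻¹ * (2⁻¹ : ℝ) ^ (1 / p) * l < f w * pweight x0 t0 ρ w},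
        ENNReal.ofReal ((f w * pweight x0 t0 ρ w) ^ p)
          ∂(volume.restrict (parabolicCylinder n x0 t0 ρ)) := by
  have hl0 : 0 < l := lt_of_le_of_lt (by positivity) hl
  set η := (2 * c * 2 ^ (n + 2))⁻¹ * (2⁻¹ : ℝ) ^ (1 / p) with hη
  set CC := ENNReal.ofReal (10 ^ (n + 2) * (2 * (2 * c * 2 ^ (n + 2)) ^ p) * l ^ (1 - p)) with hCC
  set h : EuclideanSpace ℝ (Fin n) × ℝ → ℝ := fun w => f w * pweight x0 t0 ρ w with hh
  have hhm : Measurable h := hf.mul pweight_measurable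
  set Q0 := parabolicCylinder n x0 t0 ρ with hQ0
  have hQ0m : MeasurableSet Q0 := (cyl_open n _ _ _).measurableSet
  let F : EuclideanSpace ℝ (Fin n) × ℝ → ℝ≥0∞ := Q0.indicator fun z => ENNReal.ofReal (f z)
  have hFm : Measurable F := (hf.ennreal_ofReal).indicator hQ0m
  have hFle : ∀ z, F z ≤ ENNReal.ofReal (f z) := fun z => indicator_le_self _ _ z
  have hFint : ∫⁻ z, F z = ∫⁻ z in Q0, ENNReal.ofReal (f z) := lintegral_indicator hQ0m _
  have hFfin : ∫⁻ z, F z ≠ ∞ := by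
    rw [hFint]
    exact ne_top_of_le_ne_top
      (ENNReal.mul_ne_top ofReal_ne_top (cyl_vol_ne_top n x0 t0 ρ hρ)) hF
  have hFsub : ∀ A, MeasurableSet A → A ⊆ Q0 → ∫⁻ z in A, F z = ∫⁻ z in A, ENNReal.ofReal (f z) := by
    intro A hA hAs
    exact setLIntegral_congr_fun hA fun z hz => indicator_of_mem (hAs hz) _
  let P : EuclideanSpace ℝ (Fin n) × ℝ → Prop := fun z =>
    ∃ r y s, 0 < r ∧ s ≤ t0 ∧ z ∈ parabolicCylinder n y s r ∧
      ENNReal.ofReal l * volume (parabolicCylinder n y s r) <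
        ENNReal.ofReal (pweight x0 t0 ρ z) * ∫⁻ y in parabolicCylinder n y s r, F y
  -- almost every point of the level set satisfies `P`
  have hae : ∀ᵐ z : EuclideanSpace ℝ (Fin n) × ℝ, z ∈ Q0 → 2 ^ (n + 2) * l < h z → P z := by
    filter_upwards [diff_cyl n F hFm hFfin] with z hz hzQ hzl
    have hzd := (mem_cyl0 hρ z).1 hzQ
    have hW0 : 0 < pweight x0 t0 ρ z := weight_pos hρ hzd.2
    have h1 : 2 ^ (n + 2) * l / pweight x0 t0 ρ z < f z := by
      rw [div_lt_iff₀ hW0]; exact hzl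
    obtain ⟨a, ha1, ha2⟩ := exists_between h1
    have ha0 : 0 < a := lt_of_le_of_lt (by positivity) ha1
    have hFz : F z = ENNReal.ofReal (f z) := indicator_of_mem hzQ _
    obtain ⟨r, hr, hrδ, H⟩ := hz (ENNReal.ofReal a)
      (by rw [hFz]; exact (ENNReal.ofReal_lt_ofReal_iff_of_nonneg ha0.le).2 ha2)
      (Real.sqrt (t0 - z.2)) (Real.sqrt_pos.2 (by linarith [hzd.1]))
    have hrs : r ^ 2 < t0 - z.2 := (Real.lt_sqrt hr.le).1 hrδ
    have hr2 : 0 < r ^ 2 := by positivity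
    refine ⟨r, z.1, z.2 + r ^ 2 / 2, hr, by linarith, ⟨Metric.mem_ball_self hr, by linarith,
      by linarith⟩, ?_⟩
    set v := volume (parabolicCylinder n z.1 (z.2 + r ^ 2 / 2) r) with hv
    have hv0 : v ≠ 0 := cyl_vol_ne_zero n _ _ r hr
    have hvt : v ≠ ∞ := cyl_vol_ne_top n _ _ r hr
    set J := ∫⁻ y in parabolicCylinder n z.1 (z.2 + r ^ 2 / 2) r, F y with hJ
    have h2 : l < pweight x0 t0 ρ z * a / 2 ^ (n + 2) := by
      rw [div_lt_iff₀ hW0] at ha1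
      rw [lt_div_iff₀ (by positivity)]
      linarith
    calc ENNReal.ofReal l * v < ENNReal.ofReal (pweight x0 t0 ρ z * a / 2 ^ (n + 2)) * v :=
          ENNReal.mul_lt_mul_left hv0 hvt ((ENNReal.ofReal_lt_ofReal_iff_of_nonneg hl0.le).2 h2)
      _ = ENNReal.ofReal (pweight x0 t0 ρ z / 2 ^ (n + 2)) * (ENNReal.ofReal a * v) := by
          rw [← mul_assoc, ← ENNReal.ofReal_mul (by positivity)]; congr 2; ring
      _ ≤ ENNReal.ofReal (pweight x0 t0 ρ z / 2 ^ (n + 2)) * (ENNReal.ofReal (2 ^ (n + 2)) * J) :=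
          mul_le_mul_right H _
      _ = _ := by
          rw [← mul_assoc, ← ENNReal.ofReal_mul (by positivity)]; congr 2; field_simp
  -- choose the exit cylinders
  have hst : ∀ z, z ∈ {z | z ∈ Q0 ∧ P z} → ∃ r y s, 0 < r ∧ s ≤ t0 ∧ z ∈ parabolicCylinder n y s r ∧
      ENNReal.ofReal l * volume (parabolicCylinder n y s r) <
        ENNReal.ofReal (pweight x0 t0 ρ z) * ∫⁻ y in parabolicCylinder n y s r, F y ∧
      160 * r ≤ pdepth x0 t0 ρ z ∧
      ∀ r' y' s', 2 * r ≤ r' → s' ≤ t0 → z ∈ parabolicCylinder n y' s' r' →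
        ENNReal.ofReal (pweight x0 t0 ρ z) * ∫⁻ y in parabolicCylinder n y' s' r', F y ≤
          ENNReal.ofReal l * volume (parabolicCylinder n y' s' r') := by
    rintro z ⟨hzQ, hPz⟩
    exact exit_cyl hρ F Em 160 l hEm (by norm_num) hl0 hl.le (by rw [hFint]; exact hF) z
      ((mem_cyl0 hρ z).1 hzQ).2 hPz
  choose! r y s h1 h2 h3 h4 h5 h6 using hst
  set t := {z | z ∈ Q0 ∧ P z} with ht
  let B : EuclideanSpace ℝ (Fin n) × ℝ → Set (EuclideanSpace ℝ (Fin n) × ℝ) :=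
    fun z => parabolicCylinder n (y z) (s z) (8 * r z)
  have hzB : ∀ z ∈ t, z ∈ B z := by
    intro z hz
    obtain ⟨a1, a2, a3⟩ := h3 z hz
    have := h1 z hz
    refine ⟨Metric.ball_subset_ball (by linarith) a1, by nlinarith, a3⟩
  have hdle : ∀ z, pdepth x0 t0 ρ z ≤ ρ := by
    intro z; unfold pdepth
    have := le_max_of_le_left (b := dist z.1 x0) (c := Real.sqrt (t0 - z.2)) (dist_nonneg (x := z.1) (y := x0))
    linarith
  obtain ⟨u, hut, hdisj, hcov⟩ := Vitali.exists_disjoint_subfamily_covering_enlargement B t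
    (fun z => 8 * r z) 2 (by norm_num) (fun z hz => by have := h1 z hz; positivity) ρ
    (fun z hz => by have := h1 z hz; have := h5 z hz; have := hdle z; linarith)
    (fun z hz => ⟨z, hzB z hz⟩)
  have hBo : ∀ z, IsOpen (B z) := fun z => cyl_open n _ _ _
  have hBQ : ∀ z ∈ t, B z ⊆ Q0 := fun z hz =>
    cyl_sub hρ (by have := h1 z hz; positivity) (h2 z hz) (hzB z hz)
      (by have := h1 z hz; have := h5 z hz; linarith)
  have hucount : u.Countable := hdisj.countable_of_isOpen (fun z _ => hBo z)
    (fun z hz => ⟨z, hzB z (hut hz)⟩)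
  haveI : Countable u := hucount.to_subtype
  let Bs : EuclideanSpace ℝ (Fin n) × ℝ → Set (EuclideanSpace ℝ (Fin n) × ℝ) :=
    fun z => parabolicCylinder n (y z) (min (s z + 4 * (8 * r z) ^ 2) t0) (5 * (8 * r z))
  have hlev : MeasurableSet {w | 2 ^ (n + 2) * l < h w} := measurableSet_lt measurable_const hhm
  have hlev2 : MeasurableSet {w | η * l < h w} := measurableSet_lt measurable_const hhm
  have hest : ∀ z ∈ t, ∫⁻ w in Bs z, ENNReal.ofReal (h w) ≤
      CC * ∫⁻ w in B z ∩ {w | η * l < h w}, ENNReal.ofReal (h w ^ p) := by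
    intro z hz
    refine ball_est hρ f hf hf0 p c θ l hp0 hc hθ0 hθ hl0 RH z (r z) (s z) (y z) (h1 z hz)
      (h2 z hz) (h3 z hz) ?_ (h5 z hz) ?_
    · exact (h4 z hz).trans_le (mul_le_mul_right (lintegral_mono hFle) _)
    · intro r' y' s' a1 a2 a3 a4
      rw [← hFsub _ (cyl_open n _ _ _).measurableSet a4]
      exact h6 z hz r' y' s' a1 a2 a3
  rw [Measure.restrict_restrict hlev, Measure.restrict_restrict hlev2]
  have hsubae : ({w | 2 ^ (n + 2) * l < h w} ∩ Q0 : Set _) ≤ᵐ[volume] ⋃ z : u, Bs z := by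
    filter_upwards [hae] with z hz hzm
    have hzt : z ∈ t := ⟨hzm.2, hz hzm.2 hzm.1⟩
    obtain ⟨b, hb, hne, hle⟩ := hcov z hzt
    have : z ∈ Bs b := cyl_enlarge (by have := h1 z hzt; positivity)
      (by have := h1 b (hut hb); positivity) hle (h2 z hzt) (h2 b (hut hb)) hne (hzB z hzt)
    exact mem_iUnion.2 ⟨⟨b, hb⟩, this⟩
  calc ∫⁻ w in {w | 2 ^ (n + 2) * l < h w} ∩ Q0, ENNReal.ofReal (h w)
      ≤ ∫⁻ w in ⋃ z : u, Bs z, ENNReal.ofReal (h w) := lintegral_mono_set' hsubae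
    _ ≤ ∑' z : u, ∫⁻ w in Bs z, ENNReal.ofReal (h w) := lintegral_iUnion_le _ _
    _ ≤ ∑' z : u, CC * ∫⁻ w in B z ∩ {w | η * l < h w}, ENNReal.ofReal (h w ^ p) :=
        ENNReal.tsum_le_tsum fun z => hest z (hut z.2)
    _ = CC * ∫⁻ w in ⋃ z : u, (B z ∩ {w | η * l < h w}), ENNReal.ofReal (h w ^ p) := by
        rw [ENNReal.tsum_mul_left, lintegral_iUnion]
        · exact fun z => (hBo z).measurableSet.inter hlev2
        · intro a b hab
          have := hdisj a.2 b.2 (fun e => hab (Subtype.ext e))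
          exact Disjoint.mono inter_subset_left inter_subset_left this
    _ ≤ _ := by
        refine mul_le_mul_right (lintegral_mono_set (iUnion_subset fun z w hw => ?_)) _
        exact ⟨hw.2, hBQ z (hut z.2) hw.1⟩

lemma main_est (n : ℕ) (p c θ ε : ℝ) (hp0 : 0 < p) (hp1 : p < 1) (hc : 1 ≤ c) (hθ0 : 0 ≤ θ)
    (hθ : θ ≤ 1 / 2) (hε0 : 0 < ε) (hε1 : ε ≤ 1)
    (hε : ε * (10 ^ (n + 2) * (2 * (2 * c * 2 ^ (n + 2)) ^ p)) *
        ((2 * c * 2 ^ (n + 2))⁻¹ * (2⁻¹ : ℝ) ^ (1 / p)) ^ (p - 1) / (1 - p) ≤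
      ((2 * c * 2 ^ (n + 2))⁻¹ * (2⁻¹ : ℝ) ^ (1 / p)) / (2 * 2 ^ (n + 2)))
    {x0 : EuclideanSpace ℝ (Fin n)} {t0 ρ : ℝ} (hρ : 0 < ρ)
    (f : EuclideanSpace ℝ (Fin n) × ℝ → ℝ) (hf : Measurable f) (hf0 : ∀ z, 0 ≤ f z)
    (Em : ℝ) (hEm : 0 ≤ Em)
    (hF : ∫⁻ z in parabolicCylinder n x0 t0 ρ, ENNReal.ofReal (f z) ≤
      ENNReal.ofReal Em * volume (parabolicCylinder n x0 t0 ρ))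
    (RH : ∀ y s r, 0 < r → parabolicCylinder n y s r ⊆ parabolicCylinder n x0 t0 ρ →
      (volume (parabolicCylinder n y s (r / 8)))⁻¹ *
          ∫⁻ z in parabolicCylinder n y s (r / 8), ENNReal.ofReal (f z) ≤
        ENNReal.ofReal c * ((volume (parabolicCylinder n y s r))⁻¹ *
          ∫⁻ z in parabolicCylinder n y s r, ENNReal.ofReal (f z ^ p)) ^ (1 / p) +
        ENNReal.ofReal θ * ((volume (parabolicCylinder n y s r))⁻¹ *
          ∫⁻ z in parabolicCylinder n y s r, ENNReal.ofReal (f z))) :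
    (volume (parabolicCylinder n x0 t0 (ρ / 2)))⁻¹ *
        ∫⁻ z in parabolicCylinder n x0 t0 (ρ / 2), ENNReal.ofReal (f z ^ (1 + ε)) ≤
      ENNReal.ofReal ((2 ^ (n + 2)) ^ (1 + ε) * (2 * 2 ^ (n + 2) /
        ((2 * c * 2 ^ (n + 2))⁻¹ * (2⁻¹ : ℝ) ^ (1 / p))) * (160 ^ (n + 2)) ^ ε * 2 ^ (n + 2) *
        Em ^ (1 + ε)) := by
  set η := (2 * c * 2 ^ (n + 2))⁻¹ * (2⁻¹ : ℝ) ^ (1 / p) with hη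
  have hη0 : 0 < η := by positivity
  have hη1 : η ≤ 1 := by
    have a1 : (2 * c * 2 ^ (n + 2))⁻¹ ≤ 1 := by
      apply inv_le_one_of_one_le₀
      have : (1:ℝ) ≤ 2 ^ (n + 2) := one_le_pow₀ (by norm_num)
      nlinarith
    have a2 : (2⁻¹ : ℝ) ^ (1 / p) ≤ 1 :=
      Real.rpow_le_one (by norm_num) (by norm_num) (by positivity)
    calc η ≤ 1 * 1 := mul_le_mul a1 a2 (by positivity) zero_le_one
      _ = 1 := one_mul 1
  set Q0 := parabolicCylinder n x0 t0 ρ with hQ0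
  set Q2 := parabolicCylinder n x0 t0 (ρ / 2) with hQ2
  have hQ0m : MeasurableSet Q0 := (cyl_open n _ _ _).measurableSet
  have hQ2m : MeasurableSet Q2 := (cyl_open n _ _ _).measurableSet
  set h : EuclideanSpace ℝ (Fin n) × ℝ → ℝ := fun w => f w * pweight x0 t0 ρ w with hh
  have hhm : Measurable h := hf.mul pweight_measurable
  have hh0 : ∀ w, 0 ≤ h w := fun w => mul_nonneg (hf0 w) (pweight_nonneg hρ w)
  have hw1 : ∀ w, pweight x0 t0 ρ w ≤ 1 := by
    intro w
    unfold pweight pdepth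
    apply pow_le_one₀ (by positivity)
    rw [div_le_one hρ]
    refine max_le ?_ hρ.le
    have := le_max_of_le_left (b := dist w.1 x0) (c := Real.sqrt (t0 - w.2))
      (dist_nonneg (x := w.1) (y := x0))
    linarith
  have hhf : ∫⁻ w in Q0, ENNReal.ofReal (h w) ≤ ENNReal.ofReal Em * volume Q0 := by
    refine le_trans (lintegral_mono fun w => ENNReal.ofReal_le_ofReal ?_) hF
    exact mul_le_of_le_one_right (hf0 w) (hw1 w)
  have hfin : ∫⁻ w in Q0, ENNReal.ofReal (h w) ≠ ∞ :=
    ne_top_of_le_ne_top (ENNReal.mul_ne_top ofReal_ne_top (cyl_vol_ne_top n x0 t0 ρ hρ)) hhf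
  have key := good_lambda (volume.restrict Q0) h hhm hh0 hfin p (2 ^ (n + 2))
    (10 ^ (n + 2) * (2 * (2 * c * 2 ^ (n + 2)) ^ p)) η (160 ^ (n + 2) * Em) ε hp0 hp1
    (one_le_pow₀ (by norm_num)) hη0 hη1 (by positivity) (by positivity) hε0 hε1 hε
    (fun l hl => cover_est hρ f hf hf0 p c θ l Em hp0 hc hθ0 hθ hEm hl hF RH)
  have hQ20 : Q2 ⊆ Q0 := by
    rintro z ⟨a1, a2, a3⟩
    exact ⟨Metric.ball_subset_ball (by linarith) a1, by nlinarith, a3⟩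
  have e1 : ∫⁻ z in Q2, ENNReal.ofReal (f z ^ (1 + ε)) ≤
      ENNReal.ofReal ((2 ^ (n + 2)) ^ (1 + ε)) * ∫⁻ z in Q0, ENNReal.ofReal (h z ^ (1 + ε)) := by
    refine le_trans ?_ (mul_le_mul_right (lintegral_mono_set hQ20) _)
    rw [← lintegral_const_mul' _ _ ofReal_ne_top]
    refine setLIntegral_mono' hQ2m fun z hz => ?_
    rw [← ENNReal.ofReal_mul (by positivity), ← Real.mul_rpow (by positivity) (hh0 z)]
    apply ENNReal.ofReal_le_ofReal
    apply Real.rpow_le_rpow (hf0 z) _ (by positivity)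
    have hd := ((mem_cyl_iff_depth (ρ := ρ) (ρ / 2) (by positivity) z).1 hz).2
    have hw : 1 ≤ 2 ^ (n + 2) * pweight x0 t0 ρ z := by
      unfold pweight
      rw [← mul_pow, max_eq_left (by linarith)]
      apply one_le_pow₀
      rw [← mul_div_assoc, le_div_iff₀ hρ]; linarith
    simp only [hh]
    nlinarith [mul_le_mul_of_nonneg_left hw (hf0 z)]
  have hv : volume Q0 = ENNReal.ofReal (2 ^ (n + 2)) * volume Q2 := by
    rw [hQ0, hQ2, ← cyl_vol_mul n x0 x0 t0 t0 (ρ / 2) 2 (by positivity) two_pos]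
    congr 2; ring
  have hv0 : volume Q2 ≠ 0 := cyl_vol_ne_zero n _ _ _ (by positivity)
  have hvt : volume Q2 ≠ ∞ := cyl_vol_ne_top n _ _ _ (by positivity)
  rw [mul_comm, ← div_eq_mul_inv]
  apply ENNReal.div_le_of_le_mul
  refine (e1.trans (mul_le_mul_right (key.trans (mul_le_mul_right hhf _)) _)).trans (le_of_eq ?_)
  rw [hv, ← mul_assoc, ← mul_assoc, ← mul_assoc, ← ENNReal.ofReal_mul (by positivity),
    ← ENNReal.ofReal_mul (by positivity), ← ENNReal.ofReal_mul (by positivity)]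
  congr 2
  rw [Real.mul_rpow (by positivity) hEm, Real.rpow_add_of_nonneg hEm zero_le_one hε0.le,
    Real.rpow_one]
  ring

/-- **Gehring's lemma, parabolic form.** If `g` is measurable on an open set
`A ⊆ ℝ^{n+1}` with `|g|²` locally integrable, `q ∈ [1,2)`, `cHat ≥ 1`, `θ ≥ 0`, and the reverse
Hölder inequality
`⨍_{Q_{ρ/8}} |g|² ≤ cHat (⨍_{Q_ρ} |g|^q)^{2/q} + θ ⨍_{Q_ρ} |g|²`
holds for all parabolic cylinders `Q_ρ ⊆ A`, then there is `θ₀ = θ₀(n,q) > 0` such that if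
`θ < θ₀` there are `χ₁ > 1` and `c ≥ 1`, depending only on `n, cHat, q, θ`, with
`|g|^{2χ₁}` locally integrable on `A` and
`(⨍_{Q_{ρ/2}} |g|^{2χ₁})^{1/χ₁} ≤ c ⨍_{Q_ρ} |g|²` for all parabolic cylinders `Q_ρ ⊆ A`. -/
theorem gehring_lemma_parabolic (n : ℕ) (hn : 2 ≤ n) (q : ℝ) (hq1 : 1 ≤ q) (hq2 : q < 2) :
    ∃ θ₀ : ℝ, 0 < θ₀ ∧
      ∀ cHat θ : ℝ, 1 ≤ cHat → 0 ≤ θ → θ < θ₀ →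
        ∃ χ₁ c : ℝ, 1 < χ₁ ∧ 1 ≤ c ∧
          ∀ A : Set (EuclideanSpace ℝ (Fin n) × ℝ), IsOpen A →
          ∀ g : EuclideanSpace ℝ (Fin n) × ℝ → ℝ, Measurable g →
            LocallyIntegrableOn (fun p => |g p| ^ (2 : ℝ)) A volume →
            (∀ (x : EuclideanSpace ℝ (Fin n)) (t ρ : ℝ), 0 < ρ →
              parabolicCylinder n x t ρ ⊆ A →
                cylAvg (parabolicCylinder n x t (ρ / 8)) g 2 ≤
                  ENNReal.ofReal cHat * cylAvg (parabolicCylinder n x t ρ) g q ^ (2 / q) +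
                    ENNReal.ofReal θ * cylAvg (parabolicCylinder n x t ρ) g 2) →
            LocallyIntegrableOn (fun p => |g p| ^ (2 * χ₁)) A volume ∧
            ∀ (x : EuclideanSpace ℝ (Fin n)) (t ρ : ℝ), 0 < ρ →
              parabolicCylinder n x t ρ ⊆ A →
                cylAvg (parabolicCylinder n x t (ρ / 2)) g (2 * χ₁) ^ (1 / χ₁) ≤
                  ENNReal.ofReal c * cylAvg (parabolicCylinder n x t ρ) g 2 := by
  have hq0 : 0 < q := by linarith
  refine ⟨1 / 2, by norm_num, ?_⟩
  intro cHat θ hc hθ0 hθ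
  set p := q / 2 with hp
  have hp0 : 0 < p := by positivity
  have hp1 : p < 1 := by rw [hp]; linarith
  set η := (2 * cHat * 2 ^ (n + 2))⁻¹ * (2⁻¹ : ℝ) ^ (1 / p) with hη
  have hη0 : 0 < η := by positivity
  set C2 := 10 ^ (n + 2) * (2 * (2 * cHat * 2 ^ (n + 2)) ^ p) with hC2
  have hC20 : 0 < C2 := by positivity
  have h1p : 0 < 1 - p := by linarith
  set ε := min 1 (η / (2 * 2 ^ (n + 2)) * (1 - p) / (C2 * η ^ (p - 1))) with hεdef
  have hε0 : 0 < ε := by apply lt_min one_pos; positivity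
  have hε1 : ε ≤ 1 := min_le_left _ _
  have hε : ε * C2 * η ^ (p - 1) / (1 - p) ≤ η / (2 * 2 ^ (n + 2)) := by
    have := min_le_right 1 (η / (2 * 2 ^ (n + 2)) * (1 - p) / (C2 * η ^ (p - 1)))
    rw [← hεdef, le_div_iff₀ (by positivity)] at this
    rw [div_le_iff₀ h1p]
    linarith
  set D := (2 ^ (n + 2)) ^ (1 + ε) * (2 * 2 ^ (n + 2) / η) * (160 ^ (n + 2)) ^ ε * 2 ^ (n + 2)
    with hD
  have hD0 : 0 < D := by positivity
  have hχ : 0 < 1 + ε := by positivity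
  refine ⟨1 + ε, max 1 (D ^ (1 / (1 + ε))), by linarith, le_max_left _ _, ?_⟩
  intro A hA g hg hgloc RH
  have hexp : ∀ (e : ℝ) z, ENNReal.ofReal (|g z| ^ (2 * e)) = ENNReal.ofReal ((|g z| ^ (2 : ℝ)) ^ e) := by
    intro e z
    rw [Real.rpow_mul (abs_nonneg _)]
  have hfm : Measurable fun z => |g z| ^ (2 : ℝ) := by
    have : Measurable fun z => |g z| := by
      simpa [Real.norm_eq_abs] using hg.norm
    exact this.pow_const _
  have est : ∀ (x : EuclideanSpace ℝ (Fin n)) (t ρ : ℝ), 0 < ρ →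
      parabolicCylinder n x t ρ ⊆ A →
      cylAvg (parabolicCylinder n x t (ρ / 2)) g (2 * (1 + ε)) ^ (1 / (1 + ε)) ≤
        ENNReal.ofReal (max 1 (D ^ (1 / (1 + ε)))) * cylAvg (parabolicCylinder n x t ρ) g 2 := by
    intro x t ρ hρ hsub
    by_cases htop : cylAvg (parabolicCylinder n x t ρ) g 2 = ∞
    · rw [htop, ENNReal.mul_top]
      · exact le_top
      · simp
    set Em := (cylAvg (parabolicCylinder n x t ρ) g 2).toReal with hEm
    have hEm0 : 0 ≤ Em := toReal_nonneg
    have hEmeq : ENNReal.ofReal Em = cylAvg (parabolicCylinder n x t ρ) g 2 := ofReal_toReal htop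
    have key := main_est n p cHat θ ε hp0 hp1 hc hθ0 hθ.le hε0 hε1 hε (x0 := x) (t0 := t) hρ
      (fun z => |g z| ^ (2 : ℝ)) hfm (fun z => Real.rpow_nonneg (abs_nonneg _) _) Em hEm0 ?_ ?_
    · have e : cylAvg (parabolicCylinder n x t (ρ / 2)) g (2 * (1 + ε)) ≤
          ENNReal.ofReal (D * Em ^ (1 + ε)) := by
        unfold cylAvg
        simp only [hexp]
        exact key
      calc _ ≤ ENNReal.ofReal (D * Em ^ (1 + ε)) ^ (1 / (1 + ε)) :=
            ENNReal.rpow_le_rpow e (by positivity)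
        _ = ENNReal.ofReal (D ^ (1 / (1 + ε)) * Em) := by
            rw [ENNReal.ofReal_rpow_of_nonneg (by positivity) (by positivity),
              Real.mul_rpow hD0.le (by positivity), ← Real.rpow_mul hEm0,
              mul_one_div_cancel hχ.ne', Real.rpow_one]
        _ = ENNReal.ofReal (D ^ (1 / (1 + ε))) * ENNReal.ofReal Em :=
            ENNReal.ofReal_mul (by positivity)
        _ ≤ _ := by
            rw [hEmeq]
            exact mul_le_mul_left (ENNReal.ofReal_le_ofReal (le_max_right _ _)) _
    · rw [hEmeq]
      unfold cylAvg
      rw [mul_comm, ← mul_assoc, ENNReal.mul_inv_cancel (cyl_vol_ne_zero n x t ρ hρ)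
        (cyl_vol_ne_top n x t ρ hρ), one_mul]
    · intro y s r hr hrs
      have := RH y s r hr (hrs.trans hsub)
      unfold cylAvg at this
      have e2 : ∀ z, ENNReal.ofReal (|g z| ^ q) = ENNReal.ofReal ((|g z| ^ (2 : ℝ)) ^ p) := by
        intro z
        rw [← hexp]; congr 2; rw [hp]; ring
      simp only [e2] at this
      rw [show 2 / q = 1 / p by rw [hp]; field_simp] at this
      exact this
  refine ⟨?_, est⟩
  intro z hz
  obtain ⟨U, hU, hUi⟩ := hgloc z hz
  rw [hA.nhdsWithin_eq hz] at hU ⊢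
  obtain ⟨δ, hδ, hball⟩ := Metric.mem_nhds_iff.1 (Filter.inter_mem hU (hA.mem_nhds hz))
  set ρ := min 1 (δ / 2) with hρdef
  have hρ : 0 < ρ := by positivity
  have hρ1 : ρ ≤ 1 := min_le_left _ _
  have hρδ : ρ < δ := (min_le_right _ _).trans_lt (by linarith)
  have hρ2 : ρ ^ 2 ≤ ρ := by nlinarith
  have hρ3 : 0 < ρ ^ 2 := by positivity
  have hQsub : parabolicCylinder n z.1 (z.2 + ρ ^ 2 / 8) ρ ⊆ U ∩ A := by
    refine subset_trans ?_ hball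
    rintro w ⟨w1, w2, w3⟩
    rw [Metric.mem_ball] at *
    rw [Prod.dist_eq]
    refine max_lt (by linarith) ?_
    rw [Real.dist_eq, abs_lt]
    constructor <;> linarith
  have hmem : parabolicCylinder n z.1 (z.2 + ρ ^ 2 / 8) (ρ / 2) ∈ nhds z := by
    refine (cyl_open n _ _ _).mem_nhds ⟨Metric.mem_ball_self (by positivity), ?_, ?_⟩
    · show z.2 + ρ ^ 2 / 8 - (ρ / 2) ^ 2 < z.2
      nlinarith
    · show z.2 < z.2 + ρ ^ 2 / 8
      linarith
  have hest := est z.1 (z.2 + ρ ^ 2 / 8) ρ hρ (hQsub.trans inter_subset_right)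
  refine ⟨_, hmem, ?_, ?_⟩
  · have : Measurable fun z => |g z| ^ (2 * (1 + ε)) := by
      have : Measurable fun z => |g z| := by
        simpa [Real.norm_eq_abs] using hg.norm
      exact this.pow_const _
    exact this.aestronglyMeasurable
  · rw [hasFiniteIntegral_iff_ofReal
      (Filter.Eventually.of_forall fun w => Real.rpow_nonneg (abs_nonneg _) _)]
    have hfin : cylAvg (parabolicCylinder n z.1 (z.2 + ρ ^ 2 / 8) ρ) g 2 ≠ ∞ := by
      unfold cylAvg
      refine ENNReal.mul_ne_top (ENNReal.inv_ne_top.2 (cyl_vol_ne_zero n _ _ _ hρ)) ?_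
      have := (hUi.mono_set (hQsub.trans inter_subset_left)).2
      rw [hasFiniteIntegral_iff_ofReal
        (Filter.Eventually.of_forall fun w => Real.rpow_nonneg (abs_nonneg _) _)] at this
      exact this.ne
    have h1 := ne_top_of_le_ne_top (ENNReal.mul_ne_top ofReal_ne_top hfin) hest
    have h2 : cylAvg (parabolicCylinder n z.1 (z.2 + ρ ^ 2 / 8) (ρ / 2)) g (2 * (1 + ε)) ≠ ∞ := by
      intro htop
      rw [htop, ENNReal.top_rpow_of_pos (by positivity)] at h1
      exact h1 rfl
    unfold cylAvg at h2
    rw [lt_top_iff_ne_top]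
    intro htop
    rw [htop, ENNReal.mul_top (ENNReal.inv_ne_zero.2 (cyl_vol_ne_top n _ _ _ (by positivity)))] at h2
    exact h2 rfl
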